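/- Let g : (0,ε) → ℝ be nonnegative and integrable on (0,ε), and let t₁, t₂ : (0,ε) → ℝ be differentiable with t₁(r) ≤ t₂(r), lim_{r→0⁺} t₁(r) = lim_{r→0⁺} t₂(r) = t₀, and (t₂ − t₁)'(r) < g(r)·(t₂(r) − t₁(r)) for all r ∈ (0,ε). Then t₁ ≡ t₂ on (0,ε). -/

import Mathlib

open Set Filter

/-- Gronwall's bound for a positive function `u` on `[a, b]` with `u' ≤ g u`, where the
coefficient `g` is merely integrable. -/
theorem le_mul_exp_integral_of_deriv_le {u g : ℝ → ℝ} {a b : ℝ} (hab : a ≤ b)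
    (hd : ∀ x ∈ Icc a b, DifferentiableAt ℝ u x) (hpos : ∀ x ∈ Icc a b, 0 < u x)
    (hg : MeasureTheory.IntegrableOn g (Icc a b))
    (hderiv : ∀ x ∈ Icc a b, deriv u x ≤ g x * u x) :
    u b ≤ u a * Real.exp (∫ x in a..b, g x) := by
  have hlog : Real.log (u b) - Real.log (u a) ≤ ∫ x in a..b, g x := by
    refine intervalIntegral.sub_le_integral_of_hasDeriv_right_of_le
      (g := fun x => Real.log (u x)) (g' := fun x => deriv u x / u x) hab
      (fun x hx => ((hd x hx).continuousAt.log (hpos x hx).ne').continuousWithinAt)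
      (fun x hx => ?_) hg (fun x hx => ?_)
    · have hx := Ioo_subset_Icc_self hx
      exact ((hd x hx).hasDerivAt.log (hpos x hx).ne').hasDerivWithinAt
    · have hx := Ioo_subset_Icc_self hx
      exact (div_le_iff₀ (hpos x hx)).2 (hderiv x hx)
  have ha := hpos a (left_mem_Icc.2 hab)
  calc u b = Real.exp (Real.log (u b)) := (Real.exp_log (hpos b (right_mem_Icc.2 hab))).symm
    _ ≤ Real.exp (Real.log (u a) + ∫ x in a..b, g x) := Real.exp_le_exp.2 (by linarith)
    _ = u a * Real.exp (∫ x in a..b, g x) := by rw [Real.exp_add, Real.exp_log ha]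

/-- Gronwall-type uniqueness: if `g ≥ 0` is integrable on `(0,ε)`,
`t₁ ≤ t₂` are differentiable on `(0,ε)` with a common limit `t₀` at `0⁺` and
`(t₂ - t₁)'(r) < g(r)(t₂(r) - t₁(r))` on `(0,ε)`, then `t₁ ≡ t₂` on `(0,ε)`. -/
theorem stmt5 (ε t₀ : ℝ) (hε : 0 < ε) (g t₁ t₂ : ℝ → ℝ)
    (hg0 : ∀ r ∈ Ioo 0 ε, 0 ≤ g r)
    (hgint : MeasureTheory.IntegrableOn g (Ioo 0 ε))
    (hd₁ : ∀ r ∈ Ioo 0 ε, DifferentiableAt ℝ t₁ r)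
    (hd₂ : ∀ r ∈ Ioo 0 ε, DifferentiableAt ℝ t₂ r)
    (hle : ∀ r ∈ Ioo 0 ε, t₁ r ≤ t₂ r)
    (hlim₁ : Tendsto t₁ (nhdsWithin 0 (Ioi 0)) (nhds t₀))
    (hlim₂ : Tendsto t₂ (nhdsWithin 0 (Ioi 0)) (nhds t₀))
    (hineq : ∀ r ∈ Ioo 0 ε, deriv (fun s => t₂ s - t₁ s) r < g r * (t₂ r - t₁ r)) :
    ∀ r ∈ Ioo 0 ε, t₁ r = t₂ r := by
  set u : ℝ → ℝ := fun s => t₂ s - t₁ s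
  have hpos : ∀ r ∈ Ioo 0 ε, 0 < u r := by
    intro r hr
    refine (sub_nonneg.2 (hle r hr)).lt_of_ne fun h0 => ?_
    have hmin : IsLocalMin u r := by
      filter_upwards [Ioo_mem_nhds hr.1 hr.2] with s hs
      exact h0.symm.trans_le (sub_nonneg.2 (hle s hs))
    have := hineq r hr
    rw [hmin.deriv_eq_zero, ← h0, mul_zero] at this
    exact this.false
  intro b hb
  have hlim : Tendsto (fun a => u a * Real.exp (∫ x in Ioo 0 ε, g x))
      (nhdsWithin 0 (Ioi 0)) (nhds 0) := by
    simpa using (hlim₂.sub hlim₁).mul_const (Real.exp (∫ x in Ioo 0 ε, g x))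
  have hub : u b ≤ 0 := by
    refine ge_of_tendsto hlim ?_
    filter_upwards [Ioo_mem_nhdsGT hb.1] with a ha
    have hsub : Icc a b ⊆ Ioo 0 ε := fun x hx => ⟨ha.1.trans_le hx.1, hx.2.trans_lt hb.2⟩
    refine (le_mul_exp_integral_of_deriv_le ha.2.le
      (fun x hx => (hd₂ x (hsub hx)).sub (hd₁ x (hsub hx))) (fun x hx => hpos x (hsub hx))
      (hgint.mono_set hsub) (fun x hx => (hineq x (hsub hx)).le)).trans ?_
    refine mul_le_mul_of_nonneg_left (Real.exp_le_exp.2 ?_)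
      (hpos a (hsub (left_mem_Icc.2 ha.2.le))).le
    rw [intervalIntegral.integral_of_le ha.2.le]
    exact MeasureTheory.setIntegral_mono_set hgint
      ((MeasureTheory.ae_restrict_iff' measurableSet_Ioo).2 (Eventually.of_forall hg0))
      (Ioc_subset_Icc_self.trans hsub).eventuallyLE
  exact absurd hub (hpos b hb).not_ge
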